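/- For any Nash equilibrium of the Undirected Bounded Budget Connections game on n ≥ 3 agents, the ratio of the maximum agent cost to the minimum agent cost is strictly less than 2. -/

import Mathlib

/-- The undirected graph induced by a UBBC strategy profile `s`, in which agent `i`
builds an (undirected) edge to each `j ∈ s i`. -/
def ubbcGraph {n : ℕ} (s : Fin n → Finset (Fin n)) : SimpleGraph (Fin n) :=
  SimpleGraph.fromRel (fun i j => j ∈ s i)

/-- Agent `i`'s cost under strategy profile `s`: the sum of shortest-path distances
from `i` to all other agents (infinite if some agent is unreachable). -/
noncomputable def ubbcCost {n : ℕ} (s : Fin n → Finset (Fin n)) (i : Fin n) : ℕ∞ :=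
  ∑ j : Fin n, (ubbcGraph s).edist i j

/-- A strategy profile `s` is a Nash equilibrium of the UBBC instance with budgets `k`
if every strategy respects its budget and no agent can strictly decrease its cost by
unilaterally changing its own link set. -/
noncomputable def ubbcNash {n : ℕ} (k : Fin n → ℕ) (s : Fin n → Finset (Fin n)) : Prop :=
  (∀ i, i ∉ s i ∧ (s i).card ≤ k i) ∧
  (∀ i (t : Finset (Fin n)), i ∉ t → t.card ≤ k i →
    ubbcCost s i ≤ ubbcCost (Function.update s i t) i)

open Finset

/-- If `Gnew` keeps all edges of `G` except possibly `{a,b}`, a walk of `G` either survives in `Gnew`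
or is at least as long as a route through `{a,b}`. -/
lemma walk_avoid {V : Type*} {G Gnew : SimpleGraph V} (hc : G.Connected) (a b : V)
    (h : ∀ u v, G.Adj u v → Gnew.Adj u v ∨ (u = a ∧ v = b) ∨ (u = b ∧ v = a))
    {x y : V} (p : G.Walk x y) :
    Gnew.edist x y ≤ (p.length : ℕ∞) ∨ G.dist x a + 1 + G.dist b y ≤ p.length ∨
      G.dist x b + 1 + G.dist a y ≤ p.length := by
  induction p with
  | nil => left; simp
  | @cons u v w hadj p ih =>
    have huv : G.dist u v = 1 := SimpleGraph.dist_eq_one_iff_adj.2 hadj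
    rcases ih with ih | ih | ih
    · rcases h u v hadj with h1 | ⟨rfl, rfl⟩ | ⟨rfl, rfl⟩
      · left
        have h2 : Gnew.edist u v = 1 := SimpleGraph.edist_eq_one_iff_adj.2 h1
        calc Gnew.edist u w ≤ Gnew.edist u v + Gnew.edist v w := SimpleGraph.edist_triangle
          _ ≤ 1 + (p.length : ℕ∞) := by rw [h2]; gcongr
          _ = _ := by simp [add_comm]
      · right; left
        have := SimpleGraph.dist_le p
        simp; omega
      · right; right
        have := SimpleGraph.dist_le p
        simp; omega
    · right; left
      have := hc.dist_triangle (u := u) (v := v) (w := a)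
      simp; omega
    · right; right
      have := hc.dist_triangle (u := u) (v := v) (w := b)
      simp; omega

lemma dist_avoid {V : Type*} {G Gnew : SimpleGraph V} (hc : G.Connected) (a b : V)
    (h : ∀ u v, G.Adj u v → Gnew.Adj u v ∨ (u = a ∧ v = b) ∨ (u = b ∧ v = a))
    (x y : V) :
    Gnew.edist x y ≤ (G.dist x y : ℕ∞) ∨ G.dist x a + 1 + G.dist b y ≤ G.dist x y ∨
      G.dist x b + 1 + G.dist a y ≤ G.dist x y := by
  obtain ⟨p, hp⟩ := hc.exists_walk_length_eq_dist x y
  rw [← hp]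
  exact walk_avoid hc a b h p

lemma nash_bound {n : ℕ} {k : Fin n → ℕ} {s : Fin n → Finset (Fin n)} (hnash : ubbcNash k s)
    (hconn : (ubbcGraph s).Connected) (i : Fin n) (t : Finset (Fin n)) (hi : i ∉ t)
    (ht : t.card ≤ k i) (f : Fin n → ℕ)
    (hf : ∀ v, (ubbcGraph (Function.update s i t)).edist i v ≤ (f v : ℕ∞)) :
    ∑ v, (ubbcGraph s).dist i v ≤ ∑ v, f v := by
  have h1 := hnash.2 i t hi ht
  unfold ubbcCost at h1
  have h2 : ∑ v, (ubbcGraph s).edist i v = ((∑ v, (ubbcGraph s).dist i v : ℕ) : ℕ∞) := by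
    push_cast
    refine Finset.sum_congr rfl fun v _ => ?_
    exact ((hconn i v).coe_dist_eq_edist).symm
  rw [h2] at h1
  have h3 := h1.trans (Finset.sum_le_sum fun v _ => hf v)
  exact_mod_cast h3

lemma ubbc_adj {n : ℕ} (s : Fin n → Finset (Fin n)) (u v : Fin n) :
    (ubbcGraph s).Adj u v ↔ u ≠ v ∧ (v ∈ s u ∨ u ∈ s v) := by
  simp [ubbcGraph, SimpleGraph.fromRel_adj]

lemma swap_adj {n : ℕ} (s : Fin n → Finset (Fin n)) (i w j : Fin n) (u v : Fin n)
    (h : (ubbcGraph s).Adj u v) :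
    (ubbcGraph (Function.update s i (insert j ((s i).erase w)))).Adj u v ∨
      (u = i ∧ v = w) ∨ (u = w ∧ v = i) := by
  rw [ubbc_adj] at h ⊢
  simp only [Function.update_apply]
  grind

lemma swap_new {n : ℕ} (s : Fin n → Finset (Fin n)) (i j : Fin n) (t : Finset (Fin n))
    (hij : i ≠ j) (v : Fin n) :
    (ubbcGraph (Function.update s i (insert j t))).edist i v ≤
      1 + (ubbcGraph (Function.update s i (insert j t))).edist j v := by
  have h : (ubbcGraph (Function.update s i (insert j t))).Adj i j := by
    rw [ubbc_adj]; simp [hij]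
  rw [← SimpleGraph.edist_eq_one_iff_adj.2 h]
  exact SimpleGraph.edist_triangle

lemma sum_good {n : ℕ} (d : Fin n → ℕ) (u : Fin n) :
    (∑ v, if v = u then 0 else 1 + d v) + 1 + d u = n + ∑ v, d v := by
  rw [← Finset.add_sum_erase univ d (mem_univ u),
    ← Finset.add_sum_erase univ (fun v => if v = u then 0 else 1 + d v) (mem_univ u)]
  have : ∑ x ∈ univ.erase u, (if x = u then 0 else 1 + d x) = ∑ x ∈ univ.erase u, (1 + d x) :=
    Finset.sum_congr rfl fun x hx => by simp [(Finset.mem_erase.1 hx).1]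
  rw [this, Finset.sum_add_distrib]
  have hn : 0 < n := u.pos
  simp
  omega

lemma good_or_child {n : ℕ} {k : Fin n → ℕ} (hk : ∀ i, 1 ≤ k i)
    {s : Fin n → Finset (Fin n)} (hnash : ubbcNash k s)
    (hconn : (ubbcGraph s).Connected) (j u : Fin n) (huj : u ≠ j) :
    ((∑ v, (ubbcGraph s).dist u v) + 1 + (ubbcGraph s).dist j u ≤
      n + ∑ v, (ubbcGraph s).dist j v) ∨
    ∃ w ∈ s u, (ubbcGraph s).dist j w = (ubbcGraph s).dist j u + 1 := by
  set G := ubbcGraph s with hG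
  have tri := fun a b c => hconn.dist_triangle (u := a) (v := b) (w := c)
  by_contra! hcon
  obtain ⟨hbad, hch⟩ := hcon
  have key : ∀ t : Finset (Fin n), insert j t = insert j t → u ∉ t → (insert j t).card ≤ k u →
      (∀ v, v ≠ u → (ubbcGraph (Function.update s u (insert j t))).edist u v ≤
        ((1 + G.dist j v : ℕ) : ℕ∞)) → False := by
    intro t _ hut hcard hv
    have := nash_bound hnash hconn u (insert j t) (by simp [huj, hut]) hcard
      (fun v => if v = u then 0 else 1 + G.dist j v) (by
        intro v
        by_cases h : v = u
        · subst h; simp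
        · simp only [h, if_false]; exact hv v h)
    rw [← hG] at this
    have h2 := sum_good (fun v => G.dist j v) u
    omega
  have hu : u ∉ s u := (hnash.1 u).1
  by_cases hlt : (s u).card < k u
  · refine key (s u) rfl hu ((Finset.card_insert_le _ _).trans hlt) ?_
    intro v hv
    refine (swap_new s u j _ huj v).trans ?_
    push_cast
    gcongr
    rw [(hconn j v).coe_dist_eq_edist]
    apply SimpleGraph.edist_anti
    intro a b hab
    rw [ubbc_adj] at hab ⊢
    simp only [Function.update_apply]
    grind
  · have hne : (s u).Nonempty := by
      rw [← Finset.card_pos]; have := hk u; omega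
    obtain ⟨w, hw⟩ := hne
    have hwu : w ≠ u := fun h => hu (h ▸ hw)
    have hadj : G.Adj u w := by rw [hG, ubbc_adj]; exact ⟨hwu.symm, Or.inl hw⟩
    have h1 : G.dist u w = 1 := SimpleGraph.dist_eq_one_iff_adj.2 hadj
    have hle : G.dist j w ≤ G.dist j u := by
      have := hch w hw
      have := tri j u w
      omega
    refine key ((s u).erase w) rfl (by simp [hu]) ?_ ?_
    · have := Finset.card_insert_le j ((s u).erase w)
      have h3 := Finset.card_erase_add_one hw
      have := (hnash.1 u).2
      omega
    · intro v hv
      have av := dist_avoid hconn u w (swap_adj s u w j)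
      rcases av j v with h | h | h
      · refine (swap_new s u j _ huj v).trans ?_
        push_cast
        gcongr
      · have := tri j w v
        omega
      · rcases av u v with hstep | hstep | hstep
        · refine hstep.trans ?_
          have : G.dist u v ≤ 1 + G.dist j v := by omega
          exact_mod_cast this
        · have := tri j w v
          omega
        · omega

lemma exists_good {n : ℕ} {k : Fin n → ℕ} (hk : ∀ i, 1 ≤ k i)
    {s : Fin n → Finset (Fin n)} (hnash : ubbcNash k s)
    (hconn : (ubbcGraph s).Connected) (j : Fin n) : ∀ (N : ℕ) (u : Fin n), u ≠ j →
    (∑ v, (ubbcGraph s).dist j v) ≤ N + (ubbcGraph s).dist j u →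
    ∃ g, ((∑ v, (ubbcGraph s).dist g v) + 1 + (ubbcGraph s).dist j g ≤
      n + ∑ v, (ubbcGraph s).dist j v) ∧
      (ubbcGraph s).dist j g = (ubbcGraph s).dist j u + (ubbcGraph s).dist u g := by
  intro N
  have tri := fun a b c => hconn.dist_triangle (u := a) (v := b) (w := c)
  induction N with
  | zero =>
    intro u hu hN
    rcases good_or_child hk hnash hconn j u hu with h | ⟨w, hw, h⟩
    · exact ⟨u, h, by simp⟩
    · have := Finset.single_le_sum (f := fun v => (ubbcGraph s).dist j v)
        (fun _ _ => Nat.zero_le _) (mem_univ w)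
      omega
  | succ N ih =>
    intro u hu hN
    rcases good_or_child hk hnash hconn j u hu with h | ⟨w, hw, h⟩
    · exact ⟨u, h, by simp⟩
    · have hwj : w ≠ j := by rintro rfl; simp at h
      obtain ⟨g, hg, hd⟩ := ih w hwj (by omega)
      refine ⟨g, hg, ?_⟩
      have hwu : w ≠ u := by rintro rfl; omega
      have hadj : (ubbcGraph s).Adj u w := by rw [ubbc_adj]; exact ⟨hwu.symm, Or.inl hw⟩
      have h1 : (ubbcGraph s).dist u w = 1 := SimpleGraph.dist_eq_one_iff_adj.2 hadj
      have := tri u w g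
      have := tri j u g
      omega

/-- The final numerical contradiction, degenerate case. -/
lemma arith_cover (n a θ D m c : ℤ) (hn : 0 < n) (ha : 0 ≤ a) (hθ : 0 ≤ θ) (hD : 1 ≤ D)
    (hm : 1 ≤ m)
    (hA : c + 2 * m * θ + 1 + D + m ≤ n * (m + 1))
    (hB : c + 2 * D * a + 2 * D ≤ D * n)
    (hC : n * (D + m) ≤ 2 * c + n - 1 - D - m)
    (hcov : n ≤ a + θ) : False := by
  have e1 : 4 * (m * θ) < n * (m + 3 - D) := by nlinarith
  have e2 : 4 * (D * a) < n * (D + 1 - m) := by nlinarith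
  have f1 : 0 < m + 3 - D := by
    by_contra h; push Not at h; nlinarith [mul_nonneg (by omega : 0 ≤ m) hθ]
  have f2 : 0 < D + 1 - m := by
    by_contra h; push Not at h; nlinarith [mul_nonneg (by omega : 0 ≤ D) ha]
  obtain h | h | h : D = m + 2 ∨ D = m + 1 ∨ m = D := by omega
  all_goals subst h
  all_goals nlinarith [mul_nonneg (by omega : 0 ≤ m - 1) ha, mul_nonneg (by omega : 0 ≤ m - 1) hθ]

/-- The final numerical contradiction, main case. -/
lemma arith_main (n a θ D m c X : ℤ) (hn : 0 < n) (ha : 0 ≤ a) (hθ : 0 ≤ θ) (hD : 1 ≤ D)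
    (hm : 1 ≤ m) (hX : 0 ≤ X)
    (hA : c + 2 * m * θ + 1 + D + m ≤ n * (m + 1))
    (hB : c + 2 * D * a + 2 * D ≤ D * n)
    (hC : n * (D + m) + (n - a - θ) * X ≤ 2 * c + n - 1 - D - m)
    (hC0 : n * (D + m) ≤ 2 * c + n - 1 - D - m)
    (hE : c ≤ n - 1 - D + a * (X + 2 * m - 2))
    (hF : n - 1 + a * D ≤ c) : False := by
  have hcov : 0 < n - a - θ := by
    by_contra h; push Not at h
    exact arith_cover n a θ D m c hn ha hθ hD hm hA hB hC0 (by omega)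
  have hY : 0 ≤ (n - a - θ) * X := mul_nonneg hcov.le hX
  have hmθ : 0 ≤ (m - 1) * θ := mul_nonneg (by omega) hθ
  have hma : 0 ≤ (m - 1) * a := mul_nonneg (by omega) ha
  have hG : D + 1 ≤ X + 2 * m - 2 := by
    by_contra h; push Not at h
    nlinarith [mul_nonneg ha (by omega : 0 ≤ D - (X + 2 * m - 2))]
  have e1 : (n - a - θ) * X + 4 * (m * θ) < n * (m + 3 - D) := by nlinarith
  have e2 : (n - a - θ) * X + 4 * (D * a) < n * (D + 1 - m) := by nlinarith
  have e3 : n * (D + m - 3) + (n - a - θ) * X < 2 * (a * (X + 2 * m - 2)) := by nlinarith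
  have f1 : 0 < m + 3 - D := by
    by_contra h; push Not at h; nlinarith
  have f2 : 0 < D + 1 - m := by
    by_contra h; push Not at h; nlinarith [mul_nonneg (by omega : 0 ≤ D) ha]
  obtain h | h | h : D = m + 2 ∨ D = m + 1 ∨ m = D := by omega
  all_goals subst h
  · -- first case
    have g1 : 4 * a < n := by nlinarith
    have g2 : 4 * θ < n := by nlinarith
    have hX1 : X ≤ 1 := by
      by_contra h; push Not at h
      nlinarith [mul_nonneg hcov.le (by omega : 0 ≤ X - 2)]
    nlinarith [mul_nonneg ha (by omega : 0 ≤ 1 - X),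
      mul_nonneg (by omega : 0 ≤ n - 4 * a) (by omega : 0 ≤ m - 1)]
  · have g1 : 4 * a < n := by nlinarith
    have g2 : 2 * θ < n := by nlinarith
    have hX1 : X ≤ 2 := by
      by_contra h; push Not at h
      nlinarith [mul_nonneg hcov.le (by omega : 0 ≤ X - 3)]
    have hm2 : 2 ≤ m := by omega
    nlinarith [mul_nonneg ha (by omega : 0 ≤ 2 - X),
      mul_nonneg (by omega : 0 ≤ n - 4 * a) (by omega : 0 ≤ m - 2)]
  · have hX1 : X ≤ 1 := by
      by_contra h; push Not at h
      nlinarith [mul_nonneg hcov.le (by omega : 0 ≤ X - 2)]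
    have hm2 : 2 ≤ m := by omega
    have g1 : 4 * a < n := by nlinarith
    nlinarith [mul_nonneg ha (by omega : 0 ≤ 1 - X),
      mul_nonneg (by omega : 0 ≤ n - 4 * a) (by omega : 0 ≤ m - 2)]

/-- for any Nash equilibrium of the UBBC game on `n ≥ 3` agents (each
with budget at least one, the induced graph being connected so that all costs are
finite), the ratio of the maximum agent cost to the minimum agent cost is strictly
less than 2; i.e. every agent's cost is less than twice any other agent's cost. -/
theorem ubbc_nir_lt_two (n : ℕ) (hn : 3 ≤ n) (k : Fin n → ℕ) (hk : ∀ i, 1 ≤ k i)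
    (s : Fin n → Finset (Fin n)) (hnash : ubbcNash k s)
    (hconn : (ubbcGraph s).Connected) :
    ∀ i j : Fin n,
      (∑ v : Fin n, (ubbcGraph s).dist i v) < 2 * ∑ v : Fin n, (ubbcGraph s).dist j v := by
  classical
  intro i j
  by_contra! hcon
  set G := ubbcGraph s with hG
  have tri := fun a b c => hconn.dist_triangle (u := a) (v := b) (w := c)
  have sym := fun a b => SimpleGraph.dist_comm (G := G) (u := a) (v := b)
  have hpos : ∀ a b, a ≠ b → 1 ≤ G.dist a b := fun a b h => hconn.pos_dist_of_ne h
  -- trivial lower bound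
  have hcj : n ≤ (∑ v, G.dist j v) + 1 := by
    have h1 : ∑ v, (if v = j then 0 else 1) ≤ ∑ v, G.dist j v := by
      refine Finset.sum_le_sum fun v _ => ?_
      split_ifs with h
      · exact Nat.zero_le _
      · exact hpos j v (Ne.symm h)
    have h2 := sum_good (fun _ : Fin n => 0) j
    simp only [add_zero, Finset.sum_const_zero] at h2
    omega
  have hij : i ≠ j := by rintro rfl; omega
  have hD1 := hpos j i hij.symm
  have goc := good_or_child hk hnash hconn j i hij
  rw [← hG] at goc
  rcases goc with h | ⟨w, hw, hjw⟩
  · omega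
  have hiw_b : i ≠ w := fun h => (hnash.1 i).1 (h ▸ hw)
  have hwj : w ≠ j := by rintro rfl; simp at hjw
  have hiw : G.dist i w = 1 :=
    SimpleGraph.dist_eq_one_iff_adj.2 (by rw [hG, ubbc_adj]; exact ⟨hiw_b, Or.inl hw⟩)
  obtain ⟨g, hg, hjg⟩ := exists_good hk hnash hconn j (∑ v, G.dist j v) w hwj (by rw [← hG]; omega)
  rw [← hG] at hg hjg
  obtain ⟨D, hD⟩ : ∃ D, D = G.dist j i := ⟨_, rfl⟩
  obtain ⟨m, hm⟩ : ∃ m, m = G.dist w g + 1 := ⟨_, rfl⟩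
  have hig : G.dist i g = m := by
    have := tri i w g
    have := tri j i g
    omega
  have hjg_b : G.dist j g = D + m := by omega
  set t := insert j ((s i).erase w) with ht
  set Gnew := ubbcGraph (Function.update s i t) with hG_b
  have av := dist_avoid hconn i w (swap_adj s i w j)
  set A := univ.filter (fun v => ¬ (Gnew.edist j v ≤ (G.dist j v : ℕ∞))) with hAdef
  set T := univ.filter (fun v => m + G.dist i v ≤ G.dist g v) with hTdef
  have hA : ∀ v ∈ A, G.dist j v = D + 1 + G.dist w v ∧ G.dist i v = 1 + G.dist w v := by
    intro v hv
    have hv_b := (Finset.mem_filter.1 hv).2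
    have t1 := tri j w v
    have t2 := tri j i v
    have t3 := tri i w v
    rcases av j v with h | h | h
    · exact absurd h hv_b
    · omega
    · omega
  have hiA : i ∉ A := by
    intro h; have := (hA i h).2; rw [SimpleGraph.dist_self] at this; omega
  -- (I)
  have I1 : (∑ v, G.dist g v) + 1 + (D + m) ≤ n + ∑ v, G.dist j v := by
    rw [← hjg_b]; exact hg
  -- (III)
  have I3 : (∑ v, G.dist i v) + 2 * m * T.card ≤ (∑ v, G.dist g v) + n * m := by
    have h1 : ∑ v, (G.dist i v + if v ∈ T then 2 * m else 0) ≤ ∑ v, (G.dist g v + m) := by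
      refine Finset.sum_le_sum fun v _ => ?_
      have t1 := tri i g v
      split_ifs with h
      · have := (Finset.mem_filter.1 h).2
        omega
      · omega
    rw [Finset.sum_add_distrib, Finset.sum_add_distrib, Finset.sum_ite_mem] at h1
    simp only [Finset.univ_inter, Finset.sum_const, Finset.card_univ, Fintype.card_fin,
      smul_eq_mul] at h1
    linarith
  -- (V)
  have I5 : (∑ v, G.dist i v) + 2 * D * A.card + 2 * D ≤ (∑ v, G.dist j v) + D * n := by
    have h1 : ∑ v, (G.dist i v + if v ∈ insert i A then 2 * D else 0) ≤
        ∑ v, (G.dist j v + D) := by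
      refine Finset.sum_le_sum fun v _ => ?_
      have t1 := tri i j v
      have t2 := sym i j
      split_ifs with h
      · rcases Finset.mem_insert.1 h with rfl | h
        · simp; omega
        · have := hA v h
          omega
      · omega
    rw [Finset.sum_add_distrib, Finset.sum_add_distrib, Finset.sum_ite_mem] at h1
    simp only [Finset.univ_inter, Finset.sum_const, Finset.card_univ, Fintype.card_fin,
      smul_eq_mul, Finset.card_insert_of_notMem hiA] at h1
    linarith
  -- (VII)
  have I7 : n + A.card * D ≤ (∑ v, G.dist j v) + 1 := by
    have h1 : ∑ v, ((if v = j then 0 else 1 + 0) + if v ∈ A then D else 0) ≤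
        ∑ v, G.dist j v := by
      refine Finset.sum_le_sum fun v _ => ?_
      by_cases hv : v ∈ A
      · have := hA v hv
        simp only [hv, if_true]
        split_ifs <;> omega
      · simp only [hv, if_false]
        split_ifs with h
        · simp
        · simpa using hpos j v (Ne.symm h)
    rw [Finset.sum_add_distrib, Finset.sum_ite_mem] at h1
    simp only [Finset.univ_inter, Finset.sum_const, smul_eq_mul] at h1
    have h2 := sum_good (fun _ : Fin n => 0) j
    simp only [add_zero, Finset.sum_const_zero] at h1 h2
    omega
  -- (IV)
  have base : ∀ v, D + m ≤ G.dist g v + G.dist j v := by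
    intro v
    have t1 := tri j v g
    have t2 := sym v g
    omega
  have I40 : n * (D + m) ≤ (∑ v, G.dist g v) + ∑ v, G.dist j v := by
    rw [← Finset.sum_add_distrib]
    have h1 : ∑ _v : Fin n, (D + m) ≤ ∑ v, (G.dist g v + G.dist j v) :=
      Finset.sum_le_sum fun v _ => base v
    simpa using h1
  have hm1 : 1 ≤ m := by omega
  have hDp : 1 ≤ D := by omega
  set cj := ∑ v, G.dist j v with hcjdef
  set ci := ∑ v, G.dist i v with hcidef
  set cg := ∑ v, G.dist g v with hcgdef
  have zA : (cj : ℤ) + 2 * m * T.card + 1 + D + m ≤ n * (m + 1) := by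
    zify at I1 I3 hcon
    linarith
  have zB : (cj : ℤ) + 2 * D * A.card + 2 * D ≤ D * n := by
    zify at I5 hcon
    linarith
  have zC0 : (n : ℤ) * (D + m) ≤ 2 * cj + n - 1 - D - m := by
    zify at I1 I40
    linarith
  have zF : (n : ℤ) - 1 + A.card * D ≤ cj := by
    zify at I7
    linarith
  by_cases hne : (univ \ (A ∪ T)).Nonempty
  · obtain ⟨x, hx, hmin⟩ := Finset.exists_min_image _ (fun v => G.dist g v + G.dist j v) hne
    have hxA : x ∉ A := fun h => (Finset.mem_sdiff.1 hx).2 (Finset.mem_union_left _ h)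
    have hxT : x ∉ T := fun h => (Finset.mem_sdiff.1 hx).2 (Finset.mem_union_right _ h)
    obtain ⟨X, hX⟩ := Nat.exists_eq_add_of_le (base x)
    rw [hX] at hmin
    have I4 : n * (D + m) + (univ \ (A ∪ T)).card * X ≤ cg + cj := by
      rw [hcgdef, hcjdef, ← Finset.sum_add_distrib]
      have h1 : ∑ v : Fin n, ((D + m) + if v ∈ univ \ (A ∪ T) then X else 0) ≤
          ∑ v, (G.dist g v + G.dist j v) := by
        refine Finset.sum_le_sum fun v _ => ?_
        split_ifs with h
        · exact hmin v h
        · exact base v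
      rw [Finset.sum_add_distrib, Finset.sum_ite_mem] at h1
      simpa using h1
    have hcard : (n : ℤ) - A.card - T.card ≤ (univ \ (A ∪ T)).card := by
      have h1 := Finset.card_sdiff_add_card (univ : Finset (Fin n)) (A ∪ T)
      have h2 := Finset.card_union_le A T
      rw [Finset.union_eq_left.2 (Finset.subset_univ (A ∪ T)), Finset.card_univ,
        Fintype.card_fin] at h1
      omega
    -- (VI)
    have ejx : Gnew.edist j x ≤ (G.dist j x : ℕ∞) := by
      by_contra h
      exact hxA (Finset.mem_filter.2 ⟨mem_univ _, h⟩)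
    have egx : Gnew.edist g x ≤ (G.dist g x : ℕ∞) := by
      have t1 := tri g w x
      have t2 := sym g w
      have t3 := sym g i
      rcases av g x with h | h | h
      · exact h
      · omega
      · exact absurd (Finset.mem_filter.2 ⟨mem_univ _, by omega⟩) hxT
    have ewg : Gnew.edist w g ≤ (G.dist w g : ℕ∞) := by
      rcases av w g with h | h | h
      · exact h
      · omega
      · omega
    have I6 : ci + 1 + D ≤ n + cj + A.card * (X + 2 * m - 2) := by
      have h1 := nash_bound hnash hconn i t
        (by rw [ht]; simp [hij, (hnash.1 i).1])
        (by
          rw [ht]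
          have := Finset.card_insert_le j ((s i).erase w)
          have h3 := Finset.card_erase_add_one hw
          have := (hnash.1 i).2
          omega)
        (fun v => (if v = i then 0 else 1 + G.dist j v) + if v ∈ A then X + 2 * m - 2 else 0)
        (by
          intro v
          by_cases hvi : v = i
          · subst hvi; simp
          have new := swap_new s i j ((s i).erase w) hij v
          by_cases hv : v ∈ A
          · have hAv := hA v hv
            have ewv : Gnew.edist w v ≤ (G.dist w v : ℕ∞) := by
              rcases av w v with h | h | h
              · exact h
              · omega
              · omega
            simp only [hvi, hv, if_false, if_true]
            have e1 : Gnew.edist j v ≤ Gnew.edist j x + (Gnew.edist g x + (Gnew.edist w g + Gnew.edist w v)) := by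
              calc Gnew.edist j v ≤ Gnew.edist j x + Gnew.edist x v := SimpleGraph.edist_triangle
                _ ≤ Gnew.edist j x + (Gnew.edist x g + Gnew.edist g v) := by
                    gcongr; exact SimpleGraph.edist_triangle
                _ ≤ Gnew.edist j x + (Gnew.edist x g + (Gnew.edist g w + Gnew.edist w v)) := by
                    gcongr; exact SimpleGraph.edist_triangle
                _ = _ := by
                    rw [SimpleGraph.edist_comm (u := x) (v := g),
                      SimpleGraph.edist_comm (u := g) (v := w)]
            have e2 : Gnew.edist i v ≤
                1 + ((G.dist j x : ℕ∞) + (G.dist g x + (G.dist w g + G.dist w v))) := by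
              refine new.trans ?_
              gcongr
              refine e1.trans ?_
              gcongr
            refine e2.trans ?_
            have : 1 + (G.dist j x + (G.dist g x + (G.dist w g + G.dist w v))) ≤
                1 + G.dist j v + (X + 2 * m - 2) := by omega
            exact_mod_cast this
          · simp only [hvi, hv, if_false, add_zero]
            refine new.trans ?_
            push_cast
            gcongr
            by_contra h
            exact hv (Finset.mem_filter.2 ⟨mem_univ _, h⟩))
      rw [Finset.sum_add_distrib, Finset.sum_ite_mem] at h1
      simp only [Finset.univ_inter, Finset.sum_const, smul_eq_mul] at h1
      rw [← hG] at h1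
      have h2 := sum_good (fun v => G.dist j v) i
      omega
    have hcast : ((X + 2 * m - 2 : ℕ) : ℤ) = X + 2 * m - 2 := by omega
    refine arith_main n A.card T.card D m cj X (by omega) (by omega) (by omega) (by omega)
      (by omega) (by omega) zA zB ?_ zC0 ?_ zF
    · have h3 := mul_le_mul_of_nonneg_right hcard (by omega : (0 : ℤ) ≤ X)
      zify at I1 I4
      linarith
    · have I6_b : (ci : ℤ) + 1 + D ≤ n + cj + A.card * ((X + 2 * m - 2 : ℕ) : ℤ) := by
        exact_mod_cast I6
      rw [hcast] at I6_b
      zify at hcon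
      linarith
  · have hcov : n ≤ A.card + T.card := by
      rw [Finset.not_nonempty_iff_eq_empty, Finset.sdiff_eq_empty_iff_subset] at hne
      have h1 := Finset.card_le_card hne
      have h2 := Finset.card_union_le A T
      simp only [Finset.card_univ, Fintype.card_fin] at h1
      omega
    exact arith_cover n A.card T.card D m cj (by omega) (by omega) (by omega) (by omega)
      (by omega) zA zB zC0 (by exact_mod_cast hcov)
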